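/- Let γ ∈ [−3,−2). For every multi-index β ∈ ℕ³ there exists a constant C_β > 0 such that for all v ∈ ℝ³ with |v| > 1 one has |∂^β ℓ₁(v)| ≤ C_β ⟨v⟩^{γ−|β|} and |∂^β ℓ₂(v)| ≤ C_β ⟨v⟩^{γ+2−|β|}. -/

import Mathlib

noncomputable section

open MeasureTheory Real Filter

abbrev V3 := EuclideanSpace ℝ (Fin 3)

/-- Japanese bracket ⟨v⟩ = (1+|v|²)^{1/2}. -/
def jap (v : V3) : ℝ := Real.sqrt (1 + ‖v‖ ^ 2)

/-- Standard Gaussian μ on ℝ³. -/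
def gaussM (v : V3) : ℝ := (2 * Real.pi) ^ (-(3 : ℝ) / 2) * Real.exp (-‖v‖ ^ 2 / 2)

/-- Landau kernel matrix a_{ij}(z). -/
def aker (γ : ℝ) (z : V3) (i j : Fin 3) : ℝ :=
  ‖z‖ ^ (γ + 2) * ((if i = j then (1 : ℝ) else 0) - z i * z j / ‖z‖ ^ 2)

/-- ā_{ij} = a_{ij} * μ. -/
def abar (γ : ℝ) (v : V3) (i j : Fin 3) : ℝ := ∫ w : V3, aker γ (v - w) i j * gaussM w

def bker (γ : ℝ) (z : V3) (i : Fin 3) : ℝ := -2 * ‖z‖ ^ γ * z i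

/-- b̄_i = b_i * μ. -/
def bbar (γ : ℝ) (v : V3) (i : Fin 3) : ℝ := ∫ w : V3, bker γ (v - w) i * gaussM w

/-- J_β(v) = ∫ |v−w|^β μ(w) dw. -/
def Jfun (β : ℝ) (v : V3) : ℝ := ∫ w : V3, ‖v - w‖ ^ β * gaussM w

/-- c̄(v) = −2(γ+3) J_γ(v). -/
def cbar (γ : ℝ) (v : V3) : ℝ := -2 * (γ + 3) * Jfun γ v

/-- ℓ₁(v). -/
def ell1 (γ : ℝ) (v : V3) : ℝ :=
  ∫ w : V3, (1 - ((∑ i, v i * w i) / (‖v‖ * ‖w‖)) ^ 2) * ‖w‖ ^ (γ + 2) * gaussM (v - w)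

/-- Squared Euclidean norm of the cross product of two vectors in ℝ³. -/
def crossSq (a b : V3) : ℝ :=
  ∑ i, (crossProduct (R := ℝ) (fun k => a k) (fun k => b k) i) ^ 2

/-- ℓ₂(v). -/
def ell2 (γ : ℝ) (v : V3) : ℝ :=
  ∫ w : V3,
    (1 - (1 / 2) * crossSq (‖v‖⁻¹ • v) (‖w‖⁻¹ • w)) * ‖w‖ ^ (γ + 2) * gaussM (v - w)

/-- Projection P_v ξ on the direction v. -/
def Pv (v ξ : V3) : V3 := ((∑ i, ξ i * v i) / ‖v‖ ^ 2) • v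

/-- Partial derivative in the i-th coordinate direction. -/
def pd (i : Fin 3) (f : V3 → ℝ) : V3 → ℝ := fun v => fderiv ℝ f v (EuclideanSpace.single i 1)

/-- Anisotropic gradient ∇̃f = P_v ∇f + ⟨v⟩ (I − P_v) ∇f. -/
def anisoGrad (f : V3 → ℝ) (v : V3) : V3 :=
  Pv v (gradient f v) + jap v • (gradient f v - Pv v (gradient f v))

/-- The filter |v| → ∞ on ℝ³. -/
def normAtTop : Filter V3 := Filter.comap (fun v : V3 => ‖v‖) Filter.atTop

/-- Iterated coordinate partial derivative ∂^β for a multi-index β ∈ ℕ³. -/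
def pdMulti (β : Fin 3 → ℕ) (f : V3 → ℝ) : V3 → ℝ :=
  (pd 0)^[β 0] ((pd 1)^[β 1] ((pd 2)^[β 2] f))

theorem integrable_comp_add_right {f : V3 → ℝ} (g : V3) :
    Integrable (fun w => f (w + g)) ↔ Integrable f :=
  ⟨fun h => by simpa using h.comp_add_right (-g), fun h => h.comp_add_right g⟩

theorem integrable_pow_mul_exp_neg_sq {b : ℝ} (hb : 0 < b) (n : ℕ) :
    Integrable fun x : ℝ => x ^ n * exp (-b * x ^ 2) := by
  have h := integrable_rpow_mul_exp_neg_mul_sq hb (s := n)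
    (lt_of_lt_of_le neg_one_lt_zero n.cast_nonneg)
  simpa only [rpow_natCast] using h

theorem integral_id_mul_exp_neg_sq (b : ℝ) : ∫ x : ℝ, x * exp (-b * x ^ 2) = 0 := by
  have h := integral_neg_eq_self (fun x : ℝ => x * exp (-b * x ^ 2)) volume
  simp only [neg_sq, neg_mul, integral_neg] at h ⊢
  linarith

theorem integral_sq_mul_exp_neg_sq {b : ℝ} (hb : 0 < b) :
    ∫ x : ℝ, x ^ 2 * exp (-b * x ^ 2) = √(π / b) / (2 * b) := by
  have h := integral_mul_deriv_eq_deriv_mul_of_integrable (u := fun x : ℝ => x) (u' := fun _ => 1)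
    (v := fun x => exp (-b * x ^ 2)) (v' := fun x => exp (-b * x ^ 2) * (-b * (2 * x)))
    (fun x _ => hasDerivAt_id x)
    (fun x _ => by
      have := (((hasDerivAt_pow 2 x).const_mul (-b)).exp)
      simpa using this)
    (by
      have := (integrable_pow_mul_exp_neg_sq hb 2).const_mul (-(2 * b))
      refine this.congr (ae_of_all _ fun x => ?_)
      simp only [Pi.mul_apply]; ring)
    (by
      refine (integrable_pow_mul_exp_neg_sq hb 0).congr (ae_of_all _ fun x => ?_)
      simp)
    (by
      refine (integrable_pow_mul_exp_neg_sq hb 1).congr (ae_of_all _ fun x => ?_)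
      simp)
  have e : (fun x : ℝ => x * (exp (-b * x ^ 2) * (-b * (2 * x)))) =
      fun x => (-(2 * b)) * (x ^ 2 * exp (-b * x ^ 2)) := by
    ext x; ring
  simp only [e, integral_const_mul, one_mul, integral_gaussian] at h
  rw [eq_div_iff (by positivity)]
  linarith

/-- The weight of a coordinate `k` in the product `u i * u j`. -/
def coordWeight (i j k : Fin 3) (x : ℝ) : ℝ := (if k = i then x else 1) * (if k = j then x else 1)

theorem prod_coordWeight (b : ℝ) (i j : Fin 3) (u : V3) :
    u i * u j * exp (-b * ‖u‖ ^ 2) = ∏ k, coordWeight i j k (u k) * exp (-b * u k ^ 2) := by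
  rw [Finset.prod_mul_distrib, ← exp_sum, ← Finset.mul_sum, EuclideanSpace.real_norm_sq_eq]
  simp only [coordWeight, Finset.prod_mul_distrib, Finset.prod_ite_eq', Finset.mem_univ, if_true]

theorem integrable_coordWeight {b : ℝ} (hb : 0 < b) (i j k : Fin 3) :
    Integrable fun x : ℝ => coordWeight i j k x * exp (-b * x ^ 2) := by
  have h0 := integrable_pow_mul_exp_neg_sq hb 0
  have h1 := integrable_pow_mul_exp_neg_sq hb 1
  have h2 := integrable_pow_mul_exp_neg_sq hb 2
  simp only [pow_zero, pow_one, sq, neg_mul, one_mul] at h0 h1 h2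
  unfold coordWeight
  split_ifs <;> simpa [sq]

theorem integrable_coord_mul_gaussian {b : ℝ} (hb : 0 < b) (i j : Fin 3) :
    Integrable fun u : V3 => u i * u j * exp (-b * ‖u‖ ^ 2) := by
  simp_rw [prod_coordWeight]
  have h := Integrable.fintype_prod (μ := fun _ : Fin 3 => (volume : Measure ℝ))
    fun k => integrable_coordWeight hb i j k
  exact (PiLp.volume_preserving_ofLp (Fin 3)).integrable_comp_of_integrable h

theorem integral_coord_mul_gaussian {b : ℝ} (hb : 0 < b) (i j : Fin 3) :
    ∫ u : V3, u i * u j * exp (-b * ‖u‖ ^ 2) =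
      if i = j then √(π / b) ^ 3 / (2 * b) else 0 := by
  simp_rw [prod_coordWeight]
  have h := (PiLp.volume_preserving_ofLp (Fin 3)).integral_comp
    (MeasurableEquiv.toLp 2 (Fin 3 → ℝ)).symm.measurableEmbedding
    (fun u : Fin 3 → ℝ => ∏ k, coordWeight i j k (u k) * exp (-b * u k ^ 2))
  rw [h, integral_fintype_prod_volume_eq_prod
    (fun k x => coordWeight i j k x * exp (-b * x ^ 2)), Fin.prod_univ_three]
  have h0 := integral_gaussian b
  have h1 := integral_id_mul_exp_neg_sq b
  have h2 := integral_sq_mul_exp_neg_sq hb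
  simp only [sq, neg_mul] at h0 h1 h2
  unfold coordWeight
  fin_cases i <;> fin_cases j <;> simp [sq, h0, h1, h2] <;> ring

theorem integral_gaussian_euclidean {b : ℝ} (hb : 0 < b) :
    ∫ u : V3, exp (-b * ‖u‖ ^ 2) = √(π / b) ^ 3 := by
  have h := GaussianFourier.integral_rexp_neg_mul_sq_norm (V := V3) hb
  rw [h, sqrt_eq_rpow, ← rpow_natCast, ← rpow_mul (by positivity)]
  norm_num

theorem integrable_gaussian_euclidean {b : ℝ} (hb : 0 < b) :
    Integrable fun u : V3 => exp (-b * ‖u‖ ^ 2) := by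
  by_contra h
  have := integral_gaussian_euclidean hb
  rw [integral_undef h] at this
  have : 0 < √(π / b) ^ 3 := by positivity
  linarith

/-- The squared area of the parallelogram spanned by `v` and `w`. -/
def gram (v w : V3) : ℝ := ‖v‖ ^ 2 * ‖w‖ ^ 2 - (∑ i, v i * w i) ^ 2

theorem gram_eq_sum (v w : V3) :
    gram v w = ∑ i, ∑ j, ((if i = j then ‖v‖ ^ 2 else 0) - v i * v j) * (w i * w j) := by
  simp only [gram, EuclideanSpace.real_norm_sq_eq, Fin.sum_univ_three]
  simp
  ring

theorem gram_add_smul (v u : V3) (c : ℝ) : gram v (u + c • v) = gram v u := by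
  simp only [gram, EuclideanSpace.real_norm_sq_eq, Fin.sum_univ_three]
  simp
  ring

theorem gram_nonneg (v w : V3) : 0 ≤ gram v w := by
  simp only [gram, EuclideanSpace.real_norm_sq_eq, Fin.sum_univ_three]
  nlinarith [sq_nonneg (v 0 * w 1 - v 1 * w 0), sq_nonneg (v 0 * w 2 - v 2 * w 0),
    sq_nonneg (v 1 * w 2 - v 2 * w 1)]

theorem integrable_gram_mul_gaussian {b : ℝ} (hb : 0 < b) (v : V3) :
    Integrable fun u : V3 => gram v u * exp (-b * ‖u‖ ^ 2) := by
  simp_rw [gram_eq_sum, Finset.sum_mul, mul_assoc _ (_ * _ : ℝ) (exp _)]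
  exact integrable_finsetSum _ fun i _ => integrable_finsetSum _ fun j _ =>
    (integrable_coord_mul_gaussian hb i j).const_mul _

theorem integral_gram_mul_gaussian {b : ℝ} (hb : 0 < b) (v : V3) :
    ∫ u : V3, gram v u * exp (-b * ‖u‖ ^ 2) = ‖v‖ ^ 2 * √(π / b) ^ 3 / b := by
  simp_rw [gram_eq_sum, Finset.sum_mul, mul_assoc _ (_ * _ : ℝ) (exp _)]
  rw [integral_finsetSum _ fun i _ => integrable_finsetSum _ fun j _ =>
    (integrable_coord_mul_gaussian hb i j).const_mul _]
  simp_rw [integral_finsetSum _ fun j _ => (integrable_coord_mul_gaussian hb _ j).const_mul _,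
    integral_const_mul, integral_coord_mul_gaussian hb]
  simp only [EuclideanSpace.real_norm_sq_eq, Fin.sum_univ_three]
  simp
  field_simp
  ring

theorem exp_mul_gaussM_shift {t : ℝ} (ht : 0 < t) (v u : V3) :
    exp (-(t * ‖u + (1 + 2 * t)⁻¹ • v‖ ^ 2)) * gaussM (v - (u + (1 + 2 * t)⁻¹ • v)) =
      (2 * π) ^ (-(3 : ℝ) / 2) * exp (-(‖v‖ ^ 2 * (t / (1 + 2 * t)))) *
        exp (-((1 + 2 * t) / 2) * ‖u‖ ^ 2) := by
  have ht' : 1 + 2 * t ≠ 0 := by positivity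
  rw [gaussM, mul_left_comm, mul_assoc, ← exp_add, ← exp_add]
  congr 2
  simp only [EuclideanSpace.real_norm_sq_eq, Fin.sum_univ_three]
  simp
  field_simp
  ring

theorem gauss_const {t : ℝ} (ht : 0 < t) :
    (2 * π) ^ (-(3 : ℝ) / 2) * √(π / ((1 + 2 * t) / 2)) ^ 3 = (1 + 2 * t) ^ (-(3 : ℝ) / 2) := by
  have h1 : 0 < 1 + 2 * t := by positivity
  have h2 : 0 < 2 * π := by positivity
  rw [sqrt_eq_rpow, ← rpow_natCast, ← rpow_mul (by positivity),
    show π / ((1 + 2 * t) / 2) = (2 * π) * (1 + 2 * t)⁻¹ by field_simp,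
    mul_rpow h2.le (inv_nonneg.2 h1.le), ← mul_assoc, ← rpow_add h2,
    inv_rpow h1.le, ← rpow_neg h1.le]
  norm_num

theorem integrable_exp_mul_gaussM {t : ℝ} (ht : 0 < t) (v : V3) :
    Integrable fun w : V3 => exp (-(t * ‖w‖ ^ 2)) * gaussM (v - w) := by
  rw [← integrable_comp_add_right ((1 + 2 * t)⁻¹ • v)]
  simp_rw [exp_mul_gaussM_shift ht]
  exact (integrable_gaussian_euclidean (by positivity)).const_mul _

theorem integral_exp_mul_gaussM {t : ℝ} (ht : 0 < t) (v : V3) :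
    ∫ w : V3, exp (-(t * ‖w‖ ^ 2)) * gaussM (v - w) =
      (1 + 2 * t) ^ (-(3 : ℝ) / 2) * exp (-(‖v‖ ^ 2 * (t / (1 + 2 * t)))) := by
  rw [← integral_add_right_eq_self _ ((1 + 2 * t)⁻¹ • v)]
  simp_rw [exp_mul_gaussM_shift ht]
  rw [integral_const_mul, integral_gaussian_euclidean (by positivity), ← gauss_const ht]
  ring

theorem integrable_gram_mul_exp_mul_gaussM {t : ℝ} (ht : 0 < t) (v : V3) :
    Integrable fun w : V3 => gram v w * (exp (-(t * ‖w‖ ^ 2)) * gaussM (v - w)) := by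
  rw [← integrable_comp_add_right ((1 + 2 * t)⁻¹ • v)]
  simp_rw [exp_mul_gaussM_shift ht, gram_add_smul]
  refine ((integrable_gram_mul_gaussian (b := (1 + 2 * t) / 2) (by positivity) v).const_mul
    ((2 * π) ^ (-(3 : ℝ) / 2) * exp (-(‖v‖ ^ 2 * (t / (1 + 2 * t)))))).congr
    (ae_of_all _ fun u => ?_)
  ring

theorem integral_gram_mul_exp_mul_gaussM {t : ℝ} (ht : 0 < t) (v : V3) :
    ∫ w : V3, gram v w * (exp (-(t * ‖w‖ ^ 2)) * gaussM (v - w)) =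
      2 * ‖v‖ ^ 2 * ((1 + 2 * t) ^ (-(5 : ℝ) / 2) * exp (-(‖v‖ ^ 2 * (t / (1 + 2 * t))))) := by
  have h1 : 0 < 1 + 2 * t := by positivity
  rw [← integral_add_right_eq_self _ ((1 + 2 * t)⁻¹ • v)]
  simp_rw [exp_mul_gaussM_shift ht, gram_add_smul, mul_left_comm (gram _ _)]
  rw [integral_const_mul, integral_gram_mul_gaussian (by positivity),
    show (-(5 : ℝ) / 2) = -(3 : ℝ) / 2 - 1 by norm_num, rpow_sub_one h1.ne', ← gauss_const ht]
  field_simp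

/-- The integrand of the superposition integral `superpos`. -/
def superposIntegrand (a q : ℝ) (n : ℕ) (x t : ℝ) : ℝ :=
  t ^ (a - 1) * (1 + 2 * t) ^ (-q) * (t / (1 + 2 * t)) ^ n * exp (-(x * (t / (1 + 2 * t))))

/-- The superposition of the exponentials `exp (-(x * (t / (1 + 2 * t))))` through which the
Gaussian averages of powers of the norm are expressed. -/
def superpos (a q : ℝ) (n : ℕ) (x : ℝ) : ℝ := ∫ t in Set.Ioi 0, superposIntegrand a q n x t

theorem superposIntegrand_nonneg (a q : ℝ) (n : ℕ) (x : ℝ) {t : ℝ} (ht : 0 < t) :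
    0 ≤ superposIntegrand a q n x t := by
  unfold superposIntegrand; positivity

theorem continuousOn_superposIntegrand (a q : ℝ) (n : ℕ) (x : ℝ) :
    ContinuousOn (superposIntegrand a q n x) (Set.Ioi 0) := by
  intro t ht
  have h0 : t ≠ 0 := ne_of_gt ht
  have h1 : 1 + 2 * t ≠ 0 := by have : 0 < t := ht; positivity
  unfold superposIntegrand
  refine ContinuousAt.continuousWithinAt ?_
  fun_prop (disch := first | assumption | exact Or.inl h0 | exact Or.inl h1)

theorem aestronglyMeasurable_superposIntegrand (a q : ℝ) (n : ℕ) (x : ℝ) :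
    AEStronglyMeasurable (superposIntegrand a q n x) (volume.restrict (Set.Ioi 0)) :=
  (continuousOn_superposIntegrand a q n x).aestronglyMeasurable measurableSet_Ioi

theorem hasDerivAt_div_one_add_two_mul {t : ℝ} (ht : 0 < t) :
    HasDerivAt (fun t : ℝ => t / (1 + 2 * t)) (((1 + 2 * t) ^ 2)⁻¹) t := by
  have h1 : 1 + 2 * t ≠ 0 := by positivity
  have h := (hasDerivAt_id t).div (((hasDerivAt_id t).const_mul 2).const_add 1) h1
  refine h.congr_deriv ?_
  simp only [id]
  field_simp
  ring

theorem injOn_div_one_add_two_mul : Set.InjOn (fun t : ℝ => t / (1 + 2 * t)) (Set.Ioi 0) := by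
  intro s (hs : 0 < s) t (ht : 0 < t) h
  have h1 : 1 + 2 * s ≠ 0 := by positivity
  have h2 : 1 + 2 * t ≠ 0 := by positivity
  simp only [div_eq_div_iff h1 h2] at h
  linarith

theorem superposIntegrand_le {a q : ℝ} (hq : a + 1 ≤ q) (n : ℕ) (x : ℝ) {t : ℝ} (ht : 0 < t) :
    superposIntegrand a q n x t ≤ |((1 + 2 * t) ^ 2)⁻¹| •
      ((t / (1 + 2 * t)) ^ (a + n - 1) * exp (-(x * (t / (1 + 2 * t))))) := by
  have h1 : 0 < 1 + 2 * t := by positivity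
  have hθ : 0 < t / (1 + 2 * t) := by positivity
  rw [abs_of_pos (by positivity), smul_eq_mul, superposIntegrand, ← mul_assoc]
  refine mul_le_mul_of_nonneg_right ?_ (exp_nonneg _)
  rw [show a + n - 1 = (a - 1) + n by ring, rpow_add hθ, rpow_natCast, ← mul_assoc]
  refine mul_le_mul_of_nonneg_right ?_ (by positivity)
  rw [div_rpow ht.le h1.le, div_eq_mul_inv, ← rpow_neg h1.le, mul_left_comm]
  refine mul_le_mul_of_nonneg_left ?_ (by positivity)
  rw [← rpow_natCast, ← rpow_neg h1.le, ← rpow_add h1]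
  refine rpow_le_rpow_of_exponent_le (by linarith) ?_
  push_cast
  linarith

theorem integrableOn_rpow_mul_exp {a x : ℝ} (ha : 0 < a) (hx : 0 < x) :
    IntegrableOn (fun s : ℝ => s ^ (a - 1) * exp (-(x * s))) (Set.Ioi 0) := by
  have h := integrableOn_rpow_mul_exp_neg_mul_rpow (s := a - 1) (p := 1) (by linarith) one_pos hx
  simpa only [rpow_one, neg_mul] using h

theorem div_one_add_two_mul_image_subset :
    (fun t : ℝ => t / (1 + 2 * t)) '' Set.Ioi 0 ⊆ Set.Ioi 0 := by
  rintro _ ⟨t, ht, rfl⟩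
  have ht : 0 < t := ht
  simp only [Set.mem_Ioi]
  positivity

theorem integrableOn_superposIntegrand_majorant {a x : ℝ} (ha : 0 < a) (n : ℕ) (hx : 0 < x) :
    IntegrableOn (fun t : ℝ => |((1 + 2 * t) ^ 2)⁻¹| •
      ((t / (1 + 2 * t)) ^ (a + n - 1) * exp (-(x * (t / (1 + 2 * t)))))) (Set.Ioi 0) :=
  (integrableOn_image_iff_integrableOn_abs_deriv_smul measurableSet_Ioi
    (fun _ ht => (hasDerivAt_div_one_add_two_mul ht).hasDerivWithinAt) injOn_div_one_add_two_mul
    fun s => s ^ (a + n - 1) * exp (-(x * s))).1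
    ((integrableOn_rpow_mul_exp (a := a + n) (by positivity) hx).mono_set
      div_one_add_two_mul_image_subset)

theorem integrableOn_superposIntegrand {a q x : ℝ} (ha : 0 < a) (hq : a + 1 ≤ q) (n : ℕ)
    (hx : 0 < x) : IntegrableOn (superposIntegrand a q n x) (Set.Ioi 0) := by
  refine (integrableOn_superposIntegrand_majorant ha n hx).mono'
    (aestronglyMeasurable_superposIntegrand a q n x) ?_
  filter_upwards [ae_restrict_mem measurableSet_Ioi] with t ht
  rw [norm_of_nonneg (superposIntegrand_nonneg a q n x ht)]
  exact superposIntegrand_le hq n x ht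

theorem superpos_nonneg (a q : ℝ) (n : ℕ) (x : ℝ) : 0 ≤ superpos a q n x :=
  setIntegral_nonneg measurableSet_Ioi fun _ ht => superposIntegrand_nonneg a q n x ht

theorem superpos_le {a q x : ℝ} (ha : 0 < a) (hq : a + 1 ≤ q) (n : ℕ) (hx : 0 < x) :
    superpos a q n x ≤ Gamma (a + n) * x ^ (-(a + n)) := by
  calc superpos a q n x
      ≤ ∫ t in Set.Ioi 0, |((1 + 2 * t) ^ 2)⁻¹| •
          ((t / (1 + 2 * t)) ^ (a + n - 1) * exp (-(x * (t / (1 + 2 * t))))) :=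
        setIntegral_mono_on (integrableOn_superposIntegrand ha hq n hx)
          (integrableOn_superposIntegrand_majorant ha n hx) measurableSet_Ioi
          fun _ ht => superposIntegrand_le hq n x ht
    _ = ∫ s in (fun t : ℝ => t / (1 + 2 * t)) '' Set.Ioi 0,
          s ^ (a + n - 1) * exp (-(x * s)) :=
        (integral_image_eq_integral_abs_deriv_smul measurableSet_Ioi
          (fun _ ht => (hasDerivAt_div_one_add_two_mul ht).hasDerivWithinAt)
          injOn_div_one_add_two_mul fun s => s ^ (a + n - 1) * exp (-(x * s))).symm
    _ ≤ ∫ s in Set.Ioi 0, s ^ (a + n - 1) * exp (-(x * s)) := by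
        refine setIntegral_mono_set (integrableOn_rpow_mul_exp (by positivity) hx) ?_
          div_one_add_two_mul_image_subset.eventuallyLE
        filter_upwards [ae_restrict_mem measurableSet_Ioi] with s hs
        have hs : 0 < s := hs
        simp only [Pi.zero_apply]
        positivity
    _ = Gamma (a + n) * x ^ (-(a + n)) := by
        rw [integral_rpow_mul_exp_neg_mul_Ioi (by positivity) hx, one_div, inv_rpow hx.le,
          rpow_neg hx.le, mul_comm]

theorem hasDerivAt_superpos {a q x : ℝ} (ha : 0 < a) (hq : a + 1 ≤ q) (n : ℕ) (hx : 0 < x) :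
    HasDerivAt (superpos a q n) (-superpos a q (n + 1) x) x := by
  have h := (hasDerivAt_integral_of_dominated_loc_of_deriv_le
    (μ := volume.restrict (Set.Ioi (0 : ℝ))) (F := superposIntegrand a q n)
    (F' := fun x t => -superposIntegrand a q (n + 1) x t)
    (bound := superposIntegrand a q (n + 1) (x / 2)) (Ioi_mem_nhds (half_lt_self hx))
    (Eventually.of_forall fun y => aestronglyMeasurable_superposIntegrand a q n y)
    (integrableOn_superposIntegrand ha hq n hx)
    (aestronglyMeasurable_superposIntegrand a q (n + 1) x).neg ?_
    (integrableOn_superposIntegrand ha hq (n + 1) (half_pos hx)) ?_).2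
  · rwa [integral_neg] at h
  · filter_upwards [ae_restrict_mem measurableSet_Ioi] with t ht y (hy : x / 2 < y)
    rw [norm_neg, norm_of_nonneg (superposIntegrand_nonneg a q _ y ht)]
    have ht : 0 < t := ht
    unfold superposIntegrand
    gcongr
  · filter_upwards with t y _
    have := ((((hasDerivAt_id y).mul_const (t / (1 + 2 * t))).neg.exp).const_mul
      (t ^ (a - 1) * (1 + 2 * t) ^ (-q) * (t / (1 + 2 * t)) ^ n))
    refine this.congr_deriv ?_
    simp only [superposIntegrand, id, Pi.neg_apply, pow_succ]
    ring

theorem gaussM_nonneg (v : V3) : 0 ≤ gaussM v := by unfold gaussM; positivity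

theorem continuous_gaussM : Continuous gaussM := by unfold gaussM; fun_prop

theorem norm_rpow_average {P : V3 → ℝ} (hP : Continuous P) (hP0 : ∀ w, 0 ≤ P w) {a q K : ℝ}
    (ha : 0 < a) (hq : a + 1 ≤ q) {v : V3} (hv : v ≠ 0)
    (hint : ∀ t > 0, Integrable fun w : V3 => P w * (exp (-(t * ‖w‖ ^ 2)) * gaussM (v - w)))
    (hval : ∀ t > 0, ∫ w : V3, P w * (exp (-(t * ‖w‖ ^ 2)) * gaussM (v - w)) =
      K * ((1 + 2 * t) ^ (-q) * exp (-(‖v‖ ^ 2 * (t / (1 + 2 * t)))))) :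
    Integrable (fun w : V3 => P w * ‖w‖ ^ (-(2 * a)) * gaussM (v - w)) ∧
      ∫ w : V3, P w * ‖w‖ ^ (-(2 * a)) * gaussM (v - w) =
        K / Gamma a * superpos a q 0 (‖v‖ ^ 2) := by
  have hv2 : 0 < ‖v‖ ^ 2 := by positivity
  set f : V3 → ℝ → ℝ := fun w t =>
    t ^ (a - 1) * (P w * (exp (-(t * ‖w‖ ^ 2)) * gaussM (v - w))) with hf
  have hf0 : ∀ w, ∀ t > 0, 0 ≤ f w t := fun w t ht => by
    have := hP0 w
    have := gaussM_nonneg (v - w)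
    have ht : 0 < t := ht
    simp only [hf]; positivity
  have hin : ∀ t > 0, ∫ w, f w t = K * superposIntegrand a q 0 (‖v‖ ^ 2) t := fun t ht => by
    simp only [hf, superposIntegrand, integral_const_mul, hval t ht]
    ring
  have hmeas : AEStronglyMeasurable (Function.uncurry f)
      (volume.prod (volume.restrict (Set.Ioi 0))) := by
    refine Measurable.aestronglyMeasurable ?_
    have h1 := hP.measurable
    have h2 := continuous_gaussM.measurable
    simp only [hf, Function.uncurry_def]
    fun_prop
  have hprod : Integrable (Function.uncurry f) (volume.prod (volume.restrict (Set.Ioi 0))) := by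
    rw [integrable_prod_iff' hmeas]
    constructor
    · filter_upwards [ae_restrict_mem measurableSet_Ioi] with t ht
      exact (hint t ht).const_mul (t ^ (a - 1))
    · refine ((integrableOn_superposIntegrand ha hq 0 hv2).const_mul K).congr ?_
      filter_upwards [ae_restrict_mem measurableSet_Ioi] with t ht
      rw [← hin t ht]
      exact integral_congr_ae (ae_of_all _ fun w => (norm_of_nonneg (hf0 w t ht)).symm)
  have hout : ∀ᵐ w : V3, ∫ t in Set.Ioi 0, f w t =
      Gamma a * (P w * ‖w‖ ^ (-(2 * a)) * gaussM (v - w)) := by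
    filter_upwards [Measure.ae_ne volume (0 : V3)] with w hw
    have hw2 : 0 < ‖w‖ ^ 2 := by positivity
    have e : ∀ t, f w t = (P w * gaussM (v - w)) * (t ^ (a - 1) * exp (-(‖w‖ ^ 2 * t))) := by
      intro t; simp only [hf, mul_comm t]; ring
    simp_rw [e, integral_const_mul, integral_rpow_mul_exp_neg_mul_Ioi ha hw2]
    rw [one_div, inv_rpow hw2.le, ← rpow_neg hw2.le, ← rpow_natCast, ← rpow_mul (norm_nonneg _)]
    push_cast
    ring_nf
  have hΓ : Gamma a ≠ 0 := (Gamma_pos_of_pos ha).ne'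
  have hInt := (hprod.integral_prod_left.congr hout).const_mul (Gamma a)⁻¹
  simp only [← mul_assoc, inv_mul_cancel₀ hΓ, one_mul] at hInt
  refine ⟨hInt, ?_⟩
  have hswap := integral_integral_swap hprod
  rw [integral_congr_ae hout, integral_const_mul, setIntegral_congr_fun measurableSet_Ioi
    (fun t ht => hin t ht), integral_const_mul] at hswap
  rw [superpos, div_mul_eq_mul_div, eq_div_iff hΓ, ← hswap, mul_comm]

theorem continuous_gram (v : V3) : Continuous (gram v) := by unfold gram; fun_prop

theorem ell1_integrand_eq (γ : ℝ) {v w : V3} (hv : v ≠ 0) (hw : w ≠ 0) :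
    (1 - ((∑ i, v i * w i) / (‖v‖ * ‖w‖)) ^ 2) * ‖w‖ ^ (γ + 2) =
      (‖v‖ ^ 2)⁻¹ * (gram v w * ‖w‖ ^ γ) := by
  have h1 : 0 < ‖v‖ := norm_pos_iff.2 hv
  have h2 : 0 < ‖w‖ := norm_pos_iff.2 hw
  rw [rpow_add h2, rpow_two, gram]
  field_simp

theorem crossSq_normalize {v w : V3} (hv : v ≠ 0) (hw : w ≠ 0) :
    crossSq (‖v‖⁻¹ • v) (‖w‖⁻¹ • w) = 1 - ((∑ i, v i * w i) / (‖v‖ * ‖w‖)) ^ 2 := by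
  have h1 : ‖v‖ ≠ 0 := norm_ne_zero_iff.2 hv
  have h2 : ‖w‖ ≠ 0 := norm_ne_zero_iff.2 hw
  have h3 := EuclideanSpace.real_norm_sq_eq v
  have h4 := EuclideanSpace.real_norm_sq_eq w
  rw [Fin.sum_univ_three] at h3 h4
  have e : crossSq (‖v‖⁻¹ • v) (‖w‖⁻¹ • w) = (‖v‖⁻¹ * ‖w‖⁻¹) ^ 2 * gram v w := by
    rw [gram, h3, h4, crossSq, Fin.sum_univ_three, Fin.sum_univ_three]
    simp [crossProduct]
    ring
  rw [e, gram]
  field_simp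

theorem ell1_average {γ : ℝ} (hγ : γ ∈ Set.Ico (-3 : ℝ) (-2)) {v : V3} (hv : v ≠ 0) :
    Integrable (fun w : V3 => (1 - ((∑ i, v i * w i) / (‖v‖ * ‖w‖)) ^ 2) * ‖w‖ ^ (γ + 2) *
        gaussM (v - w)) ∧
      ell1 γ v = 2 / Gamma (-γ / 2) * superpos (-γ / 2) (5 / 2) 0 (‖v‖ ^ 2) := by
  obtain ⟨h3, h2⟩ := hγ
  have hv' : ‖v‖ ≠ 0 := norm_ne_zero_iff.2 hv
  obtain ⟨hi, he⟩ := norm_rpow_average (P := gram v) (a := -γ / 2) (q := 5 / 2)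
    (K := 2 * ‖v‖ ^ 2) (continuous_gram v) (gram_nonneg v) (by linarith) (by linarith) hv
    (fun t ht => integrable_gram_mul_exp_mul_gaussM ht v)
    (fun t ht => by rw [integral_gram_mul_exp_mul_gaussM ht v, neg_div])
  rw [show -(2 * (-γ / 2)) = γ by ring] at hi he
  have hae : (fun w : V3 => (‖v‖ ^ 2)⁻¹ * (gram v w * ‖w‖ ^ γ * gaussM (v - w))) =ᵐ[volume]
      fun w => (1 - ((∑ i, v i * w i) / (‖v‖ * ‖w‖)) ^ 2) * ‖w‖ ^ (γ + 2) * gaussM (v - w) := by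
    filter_upwards [Measure.ae_ne volume (0 : V3)] with w hw
    rw [ell1_integrand_eq γ hv hw, mul_assoc (‖v‖ ^ 2)⁻¹]
  refine ⟨(hi.const_mul _).congr hae, ?_⟩
  rw [ell1, ← integral_congr_ae hae, integral_const_mul, he]
  field_simp

theorem ell2_average {γ : ℝ} (hγ : γ ∈ Set.Ico (-3 : ℝ) (-2)) {v : V3} (hv : v ≠ 0) :
    ell2 γ v = 1 / Gamma (-(γ + 2) / 2) * superpos (-(γ + 2) / 2) (3 / 2) 0 (‖v‖ ^ 2) +
      -(1 / 2) * ell1 γ v := by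
  have h1 := (ell1_average hγ hv).1
  obtain ⟨h3, h2⟩ := hγ
  obtain ⟨hi, he⟩ := norm_rpow_average (P := fun _ => 1) (a := -(γ + 2) / 2) (q := 3 / 2)
    (K := 1) (v := v) continuous_const (fun _ => zero_le_one) (by linarith) (by linarith) hv
    (fun t ht => by simpa only [one_mul] using integrable_exp_mul_gaussM ht v)
    (fun t ht => by simp only [one_mul, integral_exp_mul_gaussM ht v, neg_div])
  rw [show -(2 * (-(γ + 2) / 2)) = γ + 2 by ring] at hi he
  rw [← he, ell1, ← integral_const_mul, ← integral_add hi (h1.const_mul _), ell2]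
  refine integral_congr_ae ?_
  filter_upwards [Measure.ae_ne volume (0 : V3)] with w hw
  rw [crossSq_normalize hv hw]
  ring

/-- Functions on `{v | 1 < ‖v‖}` generated by superpositions and coordinate functions, graded by
their order of growth. -/
inductive SymbolClass : ℝ → (V3 → ℝ) → Prop
  | superpos {a q : ℝ} (n : ℕ) (ha : 0 < a) (hq : a + 1 ≤ q) :
      SymbolClass (-(2 * (a + n))) fun v => superpos a q n (‖v‖ ^ 2)
  | coord_mul {m : ℝ} {f : V3 → ℝ} (i : Fin 3) (hf : SymbolClass m f) :
      SymbolClass (m + 1) fun v => v i * f v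
  | add {m : ℝ} {f g : V3 → ℝ} (hf : SymbolClass m f) (hg : SymbolClass m g) :
      SymbolClass m fun v => f v + g v
  | const_mul {m : ℝ} {f : V3 → ℝ} (c : ℝ) (hf : SymbolClass m f) :
      SymbolClass m fun v => c * f v
  | mono {m m' : ℝ} {f : V3 → ℝ} (h : m ≤ m') (hf : SymbolClass m f) : SymbolClass m' f
  | congr {m : ℝ} {f g : V3 → ℝ} (h : ∀ v, 1 < ‖v‖ → g v = f v) (hf : SymbolClass m f) :
      SymbolClass m g

theorem eventually_one_lt_norm {v : V3} (hv : 1 < ‖v‖) : ∀ᶠ u in nhds v, 1 < ‖u‖ :=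
  continuous_norm.continuousAt.eventually (lt_mem_nhds hv)

theorem hasFDerivAt_superpos_norm_sq {a q : ℝ} (n : ℕ) (ha : 0 < a) (hq : a + 1 ≤ q) {v : V3}
    (hv : 1 < ‖v‖) : HasFDerivAt (fun v : V3 => superpos a q n (‖v‖ ^ 2))
      (-superpos a q (n + 1) (‖v‖ ^ 2) • (2 • innerSL ℝ v)) v :=
  (hasDerivAt_superpos ha hq n (by positivity)).comp_hasFDerivAt v
    (hasStrictFDerivAt_norm_sq v).hasFDerivAt

theorem fderiv_coord_single (i j : Fin 3) (v : V3) :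
    fderiv ℝ (fun v : V3 => v i) v (EuclideanSpace.single j 1) = if i = j then 1 else 0 := by
  have h : HasFDerivAt (fun v : V3 => v i) (EuclideanSpace.proj i : V3 →L[ℝ] ℝ) v :=
    (EuclideanSpace.proj i : V3 →L[ℝ] ℝ).hasFDerivAt
  rw [h.fderiv]
  simp

theorem SymbolClass.differentiableAt_and_pd {m : ℝ} {f : V3 → ℝ} (hf : SymbolClass m f) :
    (∀ v, 1 < ‖v‖ → DifferentiableAt ℝ f v) ∧ ∀ j, SymbolClass (m - 1) (pd j f) := by
  induction hf with
  | @superpos a q n ha hq =>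
    refine ⟨fun v hv => (hasFDerivAt_superpos_norm_sq n ha hq hv).differentiableAt, fun j => ?_⟩
    refine .mono (m := -(2 * (a + (n + 1 : ℕ))) + 1) (by push_cast; linarith)
      (.congr (fun v hv => ?_)
        (.const_mul (-2) (.coord_mul j (.superpos (a := a) (q := q) (n + 1) ha hq))))
    rw [pd, (hasFDerivAt_superpos_norm_sq n ha hq hv).fderiv]
    simp [EuclideanSpace.inner_single_right]
    ring
  | @coord_mul m f i hf ih =>
    have hi : ∀ v : V3, DifferentiableAt ℝ (fun v : V3 => v i) v := fun v => by fun_prop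
    refine ⟨fun v hv => (hi v).mul (ih.1 v hv), fun j => ?_⟩
    refine .congr (fun v hv => ?_) (.add
      (.mono (m := m - 1 + 1) (by linarith) (.coord_mul i (ih.2 j)))
      (.mono (m := m) (by linarith) (.const_mul (if i = j then 1 else 0) hf)))
    rw [pd, fderiv_fun_mul (hi v) (ih.1 v hv)]
    simp only [add_apply, smul_apply, smul_eq_mul,
      fderiv_coord_single, pd]
    ring
  | add hf hg ihf ihg =>
    refine ⟨fun v hv => (ihf.1 v hv).add (ihg.1 v hv), fun j => ?_⟩
    refine .congr (fun v hv => ?_) (.add (ihf.2 j) (ihg.2 j))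
    rw [pd, fderiv_fun_add (ihf.1 v hv) (ihg.1 v hv)]
    rfl
  | const_mul c hf ih =>
    refine ⟨fun v hv => (ih.1 v hv).const_mul c, fun j => ?_⟩
    refine .congr (fun v hv => ?_) (.const_mul c (ih.2 j))
    rw [pd, fderiv_const_mul (ih.1 v hv)]
    rfl
  | mono h hf ih => exact ⟨ih.1, fun j => .mono (by linarith) (ih.2 j)⟩
  | @congr m f g h hf ih =>
    have he : ∀ v, 1 < ‖v‖ → g =ᶠ[nhds v] f := fun v hv => (eventually_one_lt_norm hv).mono h
    refine ⟨fun v hv => (ih.1 v hv).congr_of_eventuallyEq (he v hv), fun j => ?_⟩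
    refine .congr (fun v hv => ?_) (ih.2 j)
    rw [pd, (he v hv).fderiv_eq]
    rfl

theorem SymbolClass.iterate_pd {m : ℝ} {f : V3 → ℝ} (hf : SymbolClass m f) (j : Fin 3) (k : ℕ) :
    SymbolClass (m - k) ((pd j)^[k] f) := by
  induction k with
  | zero => simpa using hf
  | succ k ih =>
    rw [Function.iterate_succ_apply']
    exact .mono (by push_cast; linarith) (ih.differentiableAt_and_pd.2 j)

theorem SymbolClass.pdMulti {m : ℝ} {f : V3 → ℝ} (hf : SymbolClass m f) (β : Fin 3 → ℕ) :
    SymbolClass (m - (β 0 + β 1 + β 2 : ℕ)) (pdMulti β f) :=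
  .mono (by push_cast; linarith) (((hf.iterate_pd 2 (β 2)).iterate_pd 1 (β 1)).iterate_pd 0 (β 0))

theorem SymbolClass.exists_bound {m : ℝ} {f : V3 → ℝ} (hf : SymbolClass m f) :
    ∃ C, 0 ≤ C ∧ ∀ v, 1 < ‖v‖ → |f v| ≤ C * ‖v‖ ^ m := by
  induction hf with
  | @superpos a q n ha hq =>
    refine ⟨Gamma (a + n), (Gamma_pos_of_pos (by positivity)).le, fun v hv => ?_⟩
    rw [abs_of_nonneg (superpos_nonneg _ _ _ _)]
    refine (superpos_le ha hq n (by positivity)).trans_eq ?_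
    rw [← rpow_natCast, ← rpow_mul (norm_nonneg v)]
    push_cast
    ring_nf
  | coord_mul i hf ih =>
    obtain ⟨C, hC, h⟩ := ih
    refine ⟨C, hC, fun v hv => ?_⟩
    have hi : |v i| ≤ ‖v‖ := PiLp.norm_apply_le v i
    rw [abs_mul, rpow_add_one (by positivity)]
    calc |v i| * _ ≤ ‖v‖ * (C * ‖v‖ ^ _) :=
          mul_le_mul hi (h v hv) (abs_nonneg _) (norm_nonneg v)
      _ = _ := by ring
  | add hf hg ihf ihg =>
    obtain ⟨C, hC, h⟩ := ihf
    obtain ⟨D, hD, h'⟩ := ihg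
    refine ⟨C + D, add_nonneg hC hD, fun v hv => ?_⟩
    rw [add_mul]
    exact (abs_add_le _ _).trans (add_le_add (h v hv) (h' v hv))
  | const_mul c hf ih =>
    obtain ⟨C, hC, h⟩ := ih
    refine ⟨|c| * C, by positivity, fun v hv => ?_⟩
    rw [abs_mul, mul_assoc]
    exact mul_le_mul_of_nonneg_left (h v hv) (abs_nonneg c)
  | mono hm hf ih =>
    obtain ⟨C, hC, h⟩ := ih
    exact ⟨C, hC, fun v hv => (h v hv).trans
      (mul_le_mul_of_nonneg_left (rpow_le_rpow_of_exponent_le hv.le hm) hC)⟩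
  | congr hfg hf ih =>
    obtain ⟨C, hC, h⟩ := ih
    exact ⟨C, hC, fun v hv => hfg v hv ▸ h v hv⟩

theorem norm_rpow_le_jap_rpow {p : ℝ} (hp : p ≤ 0) {v : V3} (hv : 1 < ‖v‖) :
    ‖v‖ ^ p ≤ 2 ^ (-p) * jap v ^ p := by
  have hj : 0 < jap v := by unfold jap; positivity
  have hle : jap v ≤ 2 * ‖v‖ := by
    rw [jap, sqrt_le_left (by positivity)]
    nlinarith
  have h := rpow_le_rpow_of_nonpos (by positivity) (show jap v / 2 ≤ ‖v‖ by linarith) hp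
  refine h.trans_eq ?_
  rw [div_rpow hj.le two_pos.le, rpow_neg two_pos.le]
  field_simp

theorem SymbolClass.exists_jap_bound {m : ℝ} (hm : m ≤ 0) {f : V3 → ℝ} (hf : SymbolClass m f) :
    ∃ C, 0 ≤ C ∧ ∀ v, 1 < ‖v‖ → |f v| ≤ C * jap v ^ m := by
  obtain ⟨C, hC, h⟩ := hf.exists_bound
  refine ⟨C * 2 ^ (-m), by positivity, fun v hv => (h v hv).trans ?_⟩
  rw [mul_assoc]
  exact mul_le_mul_of_nonneg_left (norm_rpow_le_jap_rpow hm hv) hC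

theorem ne_zero_of_one_lt_norm {v : V3} (hv : 1 < ‖v‖) : v ≠ 0 :=
  norm_pos_iff.1 (one_pos.trans hv)

theorem symbolClass_ell1 {γ : ℝ} (hγ : γ ∈ Set.Ico (-3 : ℝ) (-2)) : SymbolClass γ (ell1 γ) := by
  have h : SymbolClass (-(2 * (-γ / 2 + (0 : ℕ)))) _ :=
    .superpos (a := -γ / 2) (q := 5 / 2) 0 (by linarith [hγ.2]) (by linarith [hγ.1])
  exact .mono (by push_cast; linarith) (.congr
    (fun v hv => (ell1_average hγ (ne_zero_of_one_lt_norm hv)).2) (h.const_mul _))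

theorem symbolClass_ell2 {γ : ℝ} (hγ : γ ∈ Set.Ico (-3 : ℝ) (-2)) :
    SymbolClass (γ + 2) (ell2 γ) := by
  have h : SymbolClass (-(2 * (-(γ + 2) / 2 + (0 : ℕ)))) _ :=
    .superpos (a := -(γ + 2) / 2) (q := 3 / 2) 0 (by linarith [hγ.2]) (by linarith [hγ.1])
  exact .congr (fun v hv => ell2_average hγ (ne_zero_of_one_lt_norm hv))
    (.add (.mono (by push_cast; linarith) (h.const_mul _))
      (.mono (by linarith) ((symbolClass_ell1 hγ).const_mul _)))

/-- Lemma 2.1 (d): for |v| > 1, |∂^β ℓ₁(v)| ≤ C_β ⟨v⟩^{γ−|β|} and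
|∂^β ℓ₂(v)| ≤ C_β ⟨v⟩^{γ+2−|β|}. -/
theorem stmt4 (γ : ℝ) (hγ : γ ∈ Set.Ico (-3 : ℝ) (-2)) :
    ∀ β : Fin 3 → ℕ, ∃ C > (0 : ℝ), ∀ v : V3, 1 < ‖v‖ →
      |pdMulti β (ell1 γ) v| ≤ C * jap v ^ (γ - (β 0 + β 1 + β 2 : ℕ)) ∧
      |pdMulti β (ell2 γ) v| ≤ C * jap v ^ (γ + 2 - (β 0 + β 1 + β 2 : ℕ)) := by
  intro β
  have hγ2 := hγ.2
  have hβ : (0 : ℝ) ≤ (β 0 + β 1 + β 2 : ℕ) := Nat.cast_nonneg _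
  obtain ⟨C₁, hC₁, h₁⟩ := ((symbolClass_ell1 hγ).pdMulti β).exists_jap_bound (by linarith)
  obtain ⟨C₂, hC₂, h₂⟩ := ((symbolClass_ell2 hγ).pdMulti β).exists_jap_bound (by linarith)
  refine ⟨C₁ + C₂ + 1, by positivity, fun v hv => ⟨(h₁ v hv).trans ?_, (h₂ v hv).trans ?_⟩⟩ <;>
    exact mul_le_mul_of_nonneg_right (by linarith) (rpow_nonneg (sqrt_nonneg _) _)
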